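/- Let n ≥ 3 be an integer and consider the problem −Δu = λ·(1+u)^{(n+2)/(n−2)} on the open unit ball B₁ ⊂ ℝⁿ with u = 0 on ∂B₁ and λ > 0. Then a positive smooth classical solution exists for every λ ∈ (0, n(n−2)/4], and no positive smooth classical solution exists for any λ > n(n−2)/4; that is, the extremal parameter of this Gelfand problem is λ* = n(n−2)/4. -/

import Mathlib

open Metric Real

/-- The Euclidean Laplacian of a function on `ℝⁿ`, as the sum of pure second
derivatives in the coordinate directions. -/
noncomputable def laplacian {n : ℕ} (u : EuclideanSpace ℝ (Fin n) → ℝ)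
    (x : EuclideanSpace ℝ (Fin n)) : ℝ :=
  ∑ i : Fin n, iteratedFDeriv ℝ 2 u x ![EuclideanSpace.single i 1, EuclideanSpace.single i 1]

/-- `u` is a positive smooth classical solution of `-Δu = λ (1+u)^{(n+2)/(n-2)}`
on the unit ball of `ℝⁿ` with `u = 0` on the unit sphere. -/
def IsGelfandSol (n : ℕ) (lam : ℝ) (u : EuclideanSpace ℝ (Fin n) → ℝ) : Prop :=
  ContDiff ℝ (⊤ : ℕ∞) u ∧
  (∀ x ∈ ball (0 : EuclideanSpace ℝ (Fin n)) 1, 0 < u x) ∧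
  (∀ x ∈ ball (0 : EuclideanSpace ℝ (Fin n)) 1,
    -laplacian u x = lam * (1 + u x) ^ (((n : ℝ) + 2) / ((n : ℝ) - 2))) ∧
  (∀ x ∈ sphere (0 : EuclideanSpace ℝ (Fin n)) 1, u x = 0)

open Filter Topology

section Contact

variable {E : Type*} [NormedAddCommGroup E] [InnerProductSpace ℝ E]

/-- Moving from a point of the closed unit ball in an inward direction stays in the ball. -/
lemma eventually_add_smul_mem_closedBall {x e : E} (hx : ‖x‖ ≤ 1)
    (he : ‖x‖ < 1 ∨ inner ℝ x e < 0) :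
    ∀ᶠ τ : ℝ in 𝓝[>] 0, x + τ • e ∈ closedBall (0 : E) 1 := by
  rcases he with h | h
  · have hc : ContinuousAt (fun τ : ℝ => ‖x + τ • e‖) 0 := by fun_prop
    have := hc.eventually_lt (continuousAt_const (y := (1 : ℝ))) (by simpa using h)
    filter_upwards [nhdsWithin_le_nhds this] with τ hτ
    simpa using hτ.le
  · have hc : ContinuousAt (fun τ : ℝ => 2 * inner ℝ x e + τ * ‖e‖ ^ 2) 0 := by fun_prop
    have := hc.eventually_lt (continuousAt_const (y := (0 : ℝ))) (by simp; linarith)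
    filter_upwards [nhdsWithin_le_nhds this, self_mem_nhdsWithin] with τ hτ hτ0
    have hτ0' : (0 : ℝ) < τ := hτ0
    have hsq : ‖x + τ • e‖ ^ 2 = ‖x‖ ^ 2 + τ * (2 * inner ℝ x e + τ * ‖e‖ ^ 2) := by
      rw [norm_add_sq_real, inner_smul_right, norm_smul, mul_pow, Real.norm_eq_abs, sq_abs]
      ring
    have h1 : ‖x + τ • e‖ ^ 2 ≤ 1 := by
      rw [hsq]
      nlinarith [norm_nonneg x, mul_neg_of_pos_of_neg hτ0' hτ]
    rw [mem_closedBall_zero_iff]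
    exact (sq_le_one_iff₀ (norm_nonneg _)).1 h1

lemma hasDerivAt_comp_line {z : E → ℝ} (hz : Differentiable ℝ z) (x e : E) (τ : ℝ) :
    HasDerivAt (fun s : ℝ => z (x + s • e)) (fderiv ℝ z (x + τ • e) e) τ := by
  have h1 : HasDerivAt (fun s : ℝ => x + s • e) e τ := by
    simpa using ((hasDerivAt_id τ).smul_const e).const_add x
  exact (hz (x + τ • e)).hasFDerivAt.comp_hasDerivAt τ h1

lemma hasDerivAt_fderiv_comp_line {z : E → ℝ} (hz : ContDiff ℝ 2 z) (x e : E) :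
    HasDerivAt (fun s : ℝ => fderiv ℝ z (x + s • e) e)
      (iteratedFDeriv ℝ 2 z x ![e, e]) 0 := by
  have hd : Differentiable ℝ (fderiv ℝ z) :=
    (hz.fderiv_right (m := 1) (by norm_num)).differentiable (by norm_num)
  have h1 : HasDerivAt (fun s : ℝ => x + s • e) e 0 := by
    simpa using ((hasDerivAt_id (0 : ℝ)).smul_const e).const_add x
  have h2 := (hd (x + (0 : ℝ) • e)).hasFDerivAt.comp_hasDerivAt 0 h1
  rw [iteratedFDeriv_two_apply]
  simpa using h2.clm_apply (hasDerivAt_const 0 e)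

/-- The second derivative in a direction is the second derivative along the line. -/
lemma iteratedFDeriv_two_eq_of_hasDerivAt {z : E → ℝ} (hz : ContDiff ℝ 2 z) {x e : E}
    {g' : ℝ → ℝ} {c : ℝ} (h1 : ∀ τ, HasDerivAt (fun s : ℝ => z (x + s • e)) (g' τ) τ)
    (h2 : HasDerivAt g' c 0) : iteratedFDeriv ℝ 2 z x ![e, e] = c := by
  have hg : g' = fun s : ℝ => fderiv ℝ z (x + s • e) e := by
    funext τ
    exact (h1 τ).unique (hasDerivAt_comp_line (hz.differentiable (by norm_num)) x e τ)
  rw [hg] at h2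
  exact (hasDerivAt_fderiv_comp_line hz x e).unique h2

/-- One-sided second derivative test. -/
lemma nonneg_of_hasDerivAt_hasDerivAt {g g' : ℝ → ℝ} {c : ℝ}
    (h1 : ∀ τ, HasDerivAt g (g' τ) τ) (h2 : HasDerivAt g' c 0) (h0 : g 0 = 0) (h0' : g' 0 = 0)
    (hpos : ∀ᶠ τ in 𝓝[>] 0, 0 ≤ g τ) : 0 ≤ c := by
  by_contra! hc
  have hd : ∀ τ, HasDerivAt (fun s => g s - c / 4 * s ^ 2) (g' τ - c / 2 * τ) τ := by
    intro τ
    refine ((h1 τ).sub (((hasDerivAt_id' τ).pow 2).const_mul (c / 4))).congr_deriv ?_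
    simp
    ring
  have hd' : deriv (fun s => g s - c / 4 * s ^ 2) = fun τ => g' τ - c / 2 * τ :=
    funext fun τ => (hd τ).deriv
  have hdd : HasDerivAt (fun τ => g' τ - c / 2 * τ) (c - c / 2) 0 := by
    exact (h2.sub ((hasDerivAt_id' (0 : ℝ)).const_mul (c / 2))).congr_deriv (by ring)
  have hmax := isLocalMax_of_deriv_deriv_neg (f := fun s => g s - c / 4 * s ^ 2) (x₀ := 0)
    (by rw [hd', hdd.deriv]; linarith) (by rw [hd']; simp [h0']) (hd 0).continuousAt
  obtain ⟨τ, ⟨h3, h4⟩, h5⟩ :=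
    ((hpos.and (nhdsWithin_le_nhds hmax)).and self_mem_nhdsWithin).exists
  have h5' : (0 : ℝ) < τ := h5
  simp only [h0] at h4
  nlinarith [mul_pos_of_neg_of_neg hc hc, mul_neg_of_neg_of_pos hc (pow_pos h5' 2)]

/-- At a zero with vanishing gradient in the closed unit ball of a function that is nonnegative on
the ball, the Hessian is positive semidefinite. -/
lemma iteratedFDeriv_two_nonneg_of_contact {z : E → ℝ} (hz : ContDiff ℝ 2 z)
    (hpos : ∀ x ∈ closedBall (0 : E) 1, 0 ≤ z x) {x : E} (hx : ‖x‖ ≤ 1) (h0 : z x = 0)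
    (h1 : fderiv ℝ z x = 0) (e : E) : 0 ≤ iteratedFDeriv ℝ 2 z x ![e, e] := by
  have key : ∀ e : E, (‖x‖ < 1 ∨ inner ℝ x e < 0) → 0 ≤ iteratedFDeriv ℝ 2 z x ![e, e] := by
    intro e he
    refine nonneg_of_hasDerivAt_hasDerivAt
      (hasDerivAt_comp_line (hz.differentiable (by norm_num)) x e)
      (hasDerivAt_fderiv_comp_line hz x e) (by simpa using h0) (by simp [h1]) ?_
    filter_upwards [eventually_add_smul_mem_closedBall hx he] with τ hτ using hpos _ hτ
  have key' : ∀ e : E, inner ℝ x e ≤ 0 → 0 ≤ iteratedFDeriv ℝ 2 z x ![e, e] := by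
    intro e he
    have hlim : Tendsto (fun s : ℝ => iteratedFDeriv ℝ 2 z x ![e - s • x, e - s • x])
        (𝓝[>] 0) (𝓝 (iteratedFDeriv ℝ 2 z x ![e, e])) := by
      have hc : Continuous fun s : ℝ => iteratedFDeriv ℝ 2 z x ![e - s • x, e - s • x] := by
        simp only [iteratedFDeriv_two_apply, Matrix.cons_val_zero, Matrix.cons_val_one]
        fun_prop
      simpa using (hc.tendsto 0).mono_left nhdsWithin_le_nhds
    refine ge_of_tendsto hlim ?_
    filter_upwards [self_mem_nhdsWithin] with s hs
    have hs' : (0 : ℝ) < s := hs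
    apply key
    rcases hx.lt_or_eq with h | h
    · exact Or.inl h
    · right
      rw [inner_sub_right, inner_smul_right, real_inner_self_eq_norm_sq, h]
      linarith
  rcases le_total (inner ℝ x e) 0 with h | h
  · exact key' e h
  · have := key' (-e) (by simpa using h)
    simpa [iteratedFDeriv_two_apply] using this

/-- A function that is nonnegative on the closed unit ball, vanishes on the sphere and is
`o(1 - ‖y‖)` along a sequence `y` vanishes to first order at the limit of the sequence. -/
lemma contact_of_tendsto {z : E → ℝ} (hz : ContDiff ℝ 2 z)
    (hpos : ∀ x ∈ closedBall (0 : E) 1, 0 ≤ z x) (hbd : ∀ x ∈ sphere (0 : E) 1, z x = 0)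
    {x : E} {y : ℕ → E} {ε : ℕ → ℝ} (hy : ∀ j, ‖y j‖ < 1) (hyx : Tendsto y atTop (𝓝 x))
    (hε : Tendsto ε atTop (𝓝 0)) (h : ∀ᶠ j in atTop, z (y j) ≤ ε j * (1 - ‖y j‖)) :
    ‖x‖ ≤ 1 ∧ z x = 0 ∧ fderiv ℝ z x = 0 := by
  have hx : ‖x‖ ≤ 1 := le_of_tendsto hyx.norm (Eventually.of_forall fun j => (hy j).le)
  have hdiff : Differentiable ℝ z := hz.differentiable (by norm_num)
  have h0 : z x = 0 := by
    refine le_antisymm ?_ (hpos x (by simpa using hx))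
    have h1 : Tendsto (fun j => z (y j)) atTop (𝓝 (z x)) :=
      (hz.continuous.tendsto x).comp hyx
    have h2 : Tendsto (fun j => ε j * (1 - ‖y j‖)) atTop (𝓝 (0 * (1 - ‖x‖))) :=
      hε.mul (tendsto_const_nhds.sub hyx.norm)
    simpa using le_of_tendsto_of_tendsto h1 h2 h
  refine ⟨hx, h0, ?_⟩
  rcases hx.lt_or_eq with hx1 | hx1
  · have hmin : IsLocalMin z x := by
      filter_upwards [closedBall_mem_nhds_of_mem (x := x) (c := (0 : E)) (ε := 1)
        (by simpa using hx1)] with w hw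
      rw [h0]
      exact hpos w hw
    exact hmin.fderiv_eq_zero
  have hin : ∀ e : E, inner ℝ x e < 0 → 0 ≤ fderiv ℝ z x e := by
    intro e he
    have hd := hasDerivAt_comp_line hdiff x e 0
    have hs := hd.tendsto_slope_zero_right
    simp only [zero_smul, add_zero, zero_add, h0, sub_zero] at hs
    refine ge_of_tendsto hs ?_
    filter_upwards [eventually_add_smul_mem_closedBall hx (Or.inr he), self_mem_nhdsWithin]
      with τ hτ hτ0
    exact smul_nonneg (inv_nonneg.2 (le_of_lt hτ0)) (hpos _ hτ)
  have hxx : inner ℝ x x = (1 : ℝ) := by rw [real_inner_self_eq_norm_sq, hx1]; norm_num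
  have hrad : 0 ≤ fderiv ℝ z x x := by
    by_contra! hneg
    set D := fderiv ℝ z x with hD
    have hnorm : Tendsto (fun j => ‖y j‖) atTop (𝓝 1) := hx1 ▸ hyx.norm
    have hhat : Tendsto (fun j => ‖y j‖⁻¹ • y j) atTop (𝓝 x) := by
      simpa using (hnorm.inv₀ one_ne_zero).smul hyx
    have hstr : HasStrictFDerivAt z D x := hz.hasStrictFDerivAt (by norm_num)
    have hpair : Tendsto (fun j => (y j, ‖y j‖⁻¹ • y j)) atTop (𝓝 (x, x)) :=
      hyx.prodMk_nhds hhat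
    have hb := hpair.eventually (hstr.isLittleO.bound (c := -D x / 4) (by linarith))
    have hDhat : Tendsto (fun j => D (‖y j‖⁻¹ • y j)) atTop (𝓝 (D x)) :=
      (D.continuous.tendsto x).comp hhat
    obtain ⟨j, hj1, hj2, hj3, hj4, hj5⟩ := (hb.and <|
      (hDhat.eventually_lt_const (show D x < 3 * D x / 4 by linarith)).and <|
      (hε.eventually_lt_const (show 0 < -D x / 4 by linarith)).and <|
      (hnorm.eventually_const_lt (show (0 : ℝ) < 1 by norm_num)).and h).exists
    have hsub : y j - ‖y j‖⁻¹ • y j = (-(1 - ‖y j‖)) • (‖y j‖⁻¹ • y j) := by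
      rw [smul_smul, neg_sub, sub_mul, mul_inv_cancel₀ hj4.ne', sub_smul]
      simp
    have hhat1 : ‖‖y j‖⁻¹ • y j‖ = 1 := by
      rw [norm_smul, norm_inv, norm_norm, inv_mul_cancel₀ hj4.ne']
    have hr : 0 < 1 - ‖y j‖ := sub_pos.2 (hy j)
    simp only [hsub, hbd (‖y j‖⁻¹ • y j) (by simpa using hhat1), sub_zero] at hj1
    rw [D.map_smul, norm_smul, hhat1, norm_neg, Real.norm_of_nonneg hr.le, mul_one,
      smul_eq_mul] at hj1
    have hj1' := (abs_le.1 hj1).1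
    nlinarith [mul_lt_mul_of_pos_left hj2 hr, mul_lt_mul_of_pos_left hj3 hr]
  have hrad' : fderiv ℝ z x x = 0 := by
    have := hin (-x) (by rw [inner_neg_right, hxx]; norm_num)
    rw [map_neg] at this
    linarith
  have hall : ∀ e : E, 0 ≤ fderiv ℝ z x e := by
    intro e
    have := hin (e - (inner ℝ x e + 1) • x) (by
      rw [inner_sub_right, inner_smul_right, hxx]; linarith)
    simpa [hrad'] using this
  ext e
  have h1 := hall e
  have h2 := hall (-e)
  rw [map_neg] at h2
  simpa using le_antisymm (by linarith) h1

end Contact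

section Profile

variable {n : ℕ}

lemma laplacian_sub {u v : EuclideanSpace ℝ (Fin n) → ℝ} (hu : ContDiff ℝ 2 u)
    (hv : ContDiff ℝ 2 v) (x : EuclideanSpace ℝ (Fin n)) :
    laplacian (fun y => u y - v y) x = laplacian u x - laplacian v x := by
  unfold laplacian
  rw [← Finset.sum_sub_distrib]
  refine Finset.sum_congr rfl fun i _ => ?_
  exact iteratedFDeriv_two_eq_of_hasDerivAt (hu.sub hv)
    (fun τ => (hasDerivAt_comp_line (hu.differentiable (by norm_num)) x _ τ).sub
      (hasDerivAt_comp_line (hv.differentiable (by norm_num)) x _ τ))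
    ((hasDerivAt_fderiv_comp_line hu x _).sub (hasDerivAt_fderiv_comp_line hv x _))

lemma continuous_laplacian {u : EuclideanSpace ℝ (Fin n) → ℝ} (hu : ContDiff ℝ 2 u) :
    Continuous (laplacian u) := by
  have h : Continuous (fderiv ℝ (fderiv ℝ u)) :=
    (hu.fderiv_right (m := 1) (by norm_num)).continuous_fderiv (by norm_num)
  unfold laplacian
  simp only [iteratedFDeriv_two_apply]
  fun_prop

/-- The explicit radial solutions `((1 + t) / (1 + t |x|²)) ^ ((n - 2) / 2) - 1`. -/
noncomputable def gelfandProfile (n : ℕ) (t : ℝ) (x : EuclideanSpace ℝ (Fin n)) : ℝ :=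
  ((1 + t) / (1 + t * ‖x‖ ^ 2)) ^ (((n : ℝ) - 2) / 2) - 1

lemma contDiff_gelfandProfile {t : ℝ} (ht : 0 ≤ t) :
    ContDiff ℝ (⊤ : ℕ∞) (gelfandProfile n t) := by
  have hpos : ∀ x : EuclideanSpace ℝ (Fin n), 0 < 1 + t * ‖x‖ ^ 2 := fun x => by positivity
  refine ContDiff.sub (ContDiff.rpow_const_of_ne ?_ ?_) contDiff_const
  · exact contDiff_const.div
      (contDiff_const.add (contDiff_const.mul (contDiff_norm_sq ℝ))) fun x => (hpos x).ne'
  · intro x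
    exact (div_pos (by linarith) (hpos x)).ne'

lemma laplacian_gelfandProfile (hn : 3 ≤ n) {t : ℝ} (ht : 0 ≤ t)
    (x : EuclideanSpace ℝ (Fin n)) :
    -laplacian (gelfandProfile n t) x = (n : ℝ) * ((n : ℝ) - 2) * t / (1 + t) ^ 2 *
      (1 + gelfandProfile n t x) ^ (((n : ℝ) + 2) / ((n : ℝ) - 2)) := by
  have hn' : (3 : ℝ) ≤ n := by exact_mod_cast hn
  have h1t : 0 < 1 + t := by linarith
  set k : ℝ := ((n : ℝ) - 2) / 2 with hk
  have hkpos : 0 < k := by rw [hk]; linarith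
  set a : ℝ := 1 + t * ‖x‖ ^ 2 with ha
  have hapos : 0 < a := by positivity
  have hnorm : ∀ (i : Fin n) (s : ℝ), ‖x + s • EuclideanSpace.single i (1 : ℝ)‖ ^ 2
      = ‖x‖ ^ 2 + 2 * s * x i + s ^ 2 := by
    intro i s
    rw [norm_add_sq_real, inner_smul_right, norm_smul, mul_pow, Real.norm_eq_abs, sq_abs]
    simp [EuclideanSpace.inner_single_right]
    ring
  have hsecond : ∀ i : Fin n, iteratedFDeriv ℝ 2 (gelfandProfile n t) x
      ![EuclideanSpace.single i 1, EuclideanSpace.single i 1] =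
      (1 + t) ^ k * (-k * (2 * t) * a ^ (-k - 1)
        + k * (k + 1) * (2 * t * x i) ^ 2 * a ^ (-k - 2)) := by
    intro i
    set q : ℝ → ℝ := fun s => 1 + t * ‖x + s • EuclideanSpace.single i (1 : ℝ)‖ ^ 2 with hq
    have hqpos : ∀ s, 0 < q s := fun s => by simp only [hq]; positivity
    have hq0 : q 0 = a := by simp [hq, ha]
    have hqd : ∀ s, HasDerivAt q (2 * t * x i + 2 * t * s) s := by
      intro s
      have heq : q = fun s => 1 + t * (‖x‖ ^ 2 + 2 * s * x i + s ^ 2) := by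
        funext s
        simp only [hq, hnorm]
      rw [heq]
      refine ((((((hasDerivAt_id' s).const_mul 2).mul_const (x i)).const_add
        (‖x‖ ^ 2)).add ((hasDerivAt_id' s).pow 2)).const_mul t |>.const_add 1).congr_deriv ?_
      simp
      ring
    have hline : (fun s : ℝ => gelfandProfile n t (x + s • EuclideanSpace.single i (1 : ℝ)))
        = fun s => (1 + t) ^ k * q s ^ (-k) - 1 := by
      funext s
      simp only [gelfandProfile]
      rw [Real.div_rpow h1t.le (hqpos s).le, Real.rpow_neg (hqpos s).le, div_eq_mul_inv]
    refine iteratedFDeriv_two_eq_of_hasDerivAt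
      (contDiff_infty.1 (contDiff_gelfandProfile ht) 2)
      (g' := fun s => (1 + t) ^ k * ((2 * t * x i + 2 * t * s) * -k * q s ^ (-k - 1))) ?_ ?_
    · intro s
      rw [hline]
      exact (((hqd s).rpow_const (Or.inl (hqpos s).ne')).const_mul _).sub_const 1
    · have h1 : HasDerivAt (fun s => (2 * t * x i + 2 * t * s) * -k) (2 * t * -k) 0 := by
        simpa using (((hasDerivAt_id' (0 : ℝ)).const_mul (2 * t)).const_add
          (2 * t * x i)).mul_const (-k)
      have h2 := (hqd 0).rpow_const (p := -k - 1) (Or.inl (hqpos 0).ne')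
      refine ((h1.mul h2).const_mul ((1 + t) ^ k)).congr_deriv ?_
      rw [hq0, show -k - 1 - 1 = -k - 2 by ring]
      ring
  have hsum : ∑ i, (x i) ^ 2 = ‖x‖ ^ 2 := by
    rw [EuclideanSpace.norm_sq_eq]
    simp
  have hlap : laplacian (gelfandProfile n t) x =
      (1 + t) ^ k * (-k * (2 * t) * n * a ^ (-k - 1)
        + k * (k + 1) * (4 * t ^ 2 * ‖x‖ ^ 2) * a ^ (-k - 2)) := by
    unfold laplacian
    simp only [hsecond]
    rw [← Finset.mul_sum, Finset.sum_add_distrib, ← hsum, Finset.mul_sum, Finset.mul_sum,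
      Finset.sum_mul]
    simp only [Finset.sum_const, Finset.card_univ, Fintype.card_fin, nsmul_eq_mul]
    congr 2
    · ring
    · exact Finset.sum_congr rfl fun i _ => by ring
  have hpow : (1 + gelfandProfile n t x) ^ (((n : ℝ) + 2) / ((n : ℝ) - 2))
      = (1 + t) ^ k * (1 + t) ^ 2 * a ^ (-k - 2) := by
    have h2 : ((n : ℝ) - 2) ≠ 0 := by linarith
    have hexp : k * (((n : ℝ) + 2) / ((n : ℝ) - 2)) = k + 2 := by
      rw [hk]
      field_simp
      ring
    simp only [gelfandProfile, add_sub_cancel]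
    rw [← Real.rpow_mul (div_pos h1t hapos).le, hexp, Real.div_rpow h1t.le hapos.le,
      Real.rpow_add h1t, show -k - 2 = -(k + 2) by ring, Real.rpow_neg hapos.le,
      Real.rpow_two, div_eq_mul_inv]
  have hak : a ^ (-k - 1) = a ^ (-k - 2) * a := by
    rw [show -k - 1 = (-k - 2) + 1 by ring, Real.rpow_add hapos, Real.rpow_one]
  have hnk : (n : ℝ) = 2 * k + 2 := by rw [hk]; ring
  rw [hlap, hpow, hak, hnk]
  field_simp
  rw [ha]
  ring

lemma gelfandProfile_eq_zero {t : ℝ} (ht : 0 ≤ t) {x : EuclideanSpace ℝ (Fin n)}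
    (hx : ‖x‖ = 1) : gelfandProfile n t x = 0 := by
  have h1t : 1 + t ≠ 0 := by linarith
  simp [gelfandProfile, hx, div_self h1t]

lemma gelfandProfile_pos (hn : 3 ≤ n) {t : ℝ} (ht : 0 < t) {x : EuclideanSpace ℝ (Fin n)}
    (hx : ‖x‖ < 1) : 0 < gelfandProfile n t x := by
  have hn' : (3 : ℝ) ≤ n := by exact_mod_cast hn
  have hr : ‖x‖ ^ 2 < 1 := (sq_lt_one_iff₀ (norm_nonneg _)).2 hx
  refine sub_pos.2 (Real.one_lt_rpow ?_ (by linarith))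
  rw [one_lt_div (by positivity)]
  nlinarith

lemma one_add_gelfandProfile_zero {t : ℝ} :
    1 + gelfandProfile n t 0 = (1 + t) ^ (((n : ℝ) - 2) / 2) := by
  simp [gelfandProfile]

lemma continuousAt_gelfandProfile_param {t : ℝ} (ht : 0 ≤ t) (x : EuclideanSpace ℝ (Fin n)) :
    ContinuousAt (fun s => gelfandProfile n s x) t := by
  have h1 : 1 + t * ‖x‖ ^ 2 ≠ 0 := by positivity
  have h2 : (1 + t) / (1 + t * ‖x‖ ^ 2) ≠ 0 := by positivity
  unfold gelfandProfile
  have h3 : ContinuousAt (fun s : ℝ => (1 + s) / (1 + s * ‖x‖ ^ 2)) t :=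
    ContinuousAt.div (by fun_prop) (by fun_prop) h1
  exact (h3.rpow_const (Or.inl h2)).sub continuousAt_const

/-- The profiles are Lipschitz in the parameter, with constant `O(1 - ‖x‖)`. -/
lemma gelfandProfile_add_le (hn : 3 ≤ n) {t δ : ℝ} (ht : 0 ≤ t) (hδ : 0 ≤ δ)
    (hδn : n * δ ≤ 1) {x : EuclideanSpace ℝ (Fin n)} (hx : ‖x‖ ≤ 1) :
    gelfandProfile n (t + δ) x - gelfandProfile n t x ≤
      (1 + t) ^ (((n : ℝ) - 2) / 2) * (2 * n * δ) * (1 - ‖x‖) := by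
  have hn' : (3 : ℝ) ≤ n := by exact_mod_cast hn
  have hr0 := norm_nonneg x
  set r := ‖x‖ with hr
  set k : ℝ := ((n : ℝ) - 2) / 2 with hk
  have hkpos : 0 < k := by rw [hk]; linarith
  have h1t : 0 < 1 + t := by linarith
  have hA : 0 < 1 + t * r ^ 2 := by positivity
  have hB : 0 < 1 + (t + δ) * r ^ 2 := by positivity
  have hr2 : 0 ≤ 1 - r ^ 2 := by nlinarith
  set η : ℝ := δ * (1 - r ^ 2) / ((1 + (t + δ) * r ^ 2) * (1 + t)) with hη
  have hη0 : 0 ≤ η := by positivity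
  have hηle : η ≤ δ * (1 - r ^ 2) := by
    refine div_le_self (by positivity) ?_
    have : 1 ≤ 1 + (t + δ) * r ^ 2 := by
      have : 0 ≤ (t + δ) * r ^ 2 := by positivity
      linarith
    nlinarith
  have hratio : (1 + (t + δ)) / (1 + (t + δ) * r ^ 2) = (1 + t) / (1 + t * r ^ 2) * (1 + η) := by
    rw [hη]
    field_simp
    ring
  have hkη : k * η ≤ k * (δ * (1 - r ^ 2)) := mul_le_mul_of_nonneg_left hηle hkpos.le
  have hkδ : k * (δ * (1 - r ^ 2)) ≤ n * δ / 2 * (1 - r ^ 2) := by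
    rw [← mul_assoc]
    refine mul_le_mul_of_nonneg_right ?_ hr2
    rw [hk]
    nlinarith
  have hle2 : n * δ / 2 * (1 - r ^ 2) ≤ 1 / 2 := by
    nlinarith [mul_nonneg (by positivity : (0 : ℝ) ≤ n * δ) (sq_nonneg r)]
  have hexp : (1 + η) ^ k ≤ 1 + n * δ * (1 - r ^ 2) := by
    have hkη0 : 0 ≤ k * η := by positivity
    calc (1 + η) ^ k ≤ (Real.exp η) ^ k :=
          Real.rpow_le_rpow (by positivity) (by linarith [Real.add_one_le_exp η]) hkpos.le
      _ = Real.exp (k * η) := by rw [← Real.exp_mul, mul_comm]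
      _ ≤ 1 / (1 - k * η) := Real.exp_bound_div_one_sub_of_interval hkη0 (by linarith)
      _ ≤ 1 + 2 * (k * η) := by
          rw [div_le_iff₀ (by linarith)]
          nlinarith
      _ ≤ _ := by linarith
  have hbase : ((1 + t) / (1 + t * r ^ 2)) ^ k ≤ (1 + t) ^ k := by
    refine Real.rpow_le_rpow (by positivity) (div_le_self h1t.le ?_) hkpos.le
    have : 0 ≤ t * r ^ 2 := by positivity
    linarith
  have hP : 0 ≤ ((1 + t) / (1 + t * r ^ 2)) ^ k := by positivity
  simp only [gelfandProfile, ← hr, ← hk]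
  rw [hratio, Real.mul_rpow (by positivity) (by positivity)]
  have hstep : 0 ≤ n * δ * (1 - r ^ 2) := by positivity
  calc ((1 + t) / (1 + t * r ^ 2)) ^ k * (1 + η) ^ k - 1 - (((1 + t) / (1 + t * r ^ 2)) ^ k - 1)
      = ((1 + t) / (1 + t * r ^ 2)) ^ k * ((1 + η) ^ k - 1) := by ring
    _ ≤ ((1 + t) / (1 + t * r ^ 2)) ^ k * (n * δ * (1 - r ^ 2)) :=
        mul_le_mul_of_nonneg_left (by linarith) hP
    _ ≤ (1 + t) ^ k * (n * δ * (1 - r ^ 2)) := mul_le_mul_of_nonneg_right hbase hstep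
    _ ≤ (1 + t) ^ k * (2 * n * δ * (1 - r)) := by
        refine mul_le_mul_of_nonneg_left ?_ (by positivity)
        have : 1 - r ^ 2 ≤ 2 * (1 - r) := by nlinarith [sq_nonneg (1 - r)]
        nlinarith [mul_le_mul_of_nonneg_left this (by positivity : (0 : ℝ) ≤ n * δ)]
    _ = _ := by ring

lemma exists_isGelfandSol (hn : 3 ≤ n) {lam : ℝ} (h0 : 0 < lam)
    (h1 : lam ≤ (n : ℝ) * ((n : ℝ) - 2) / 4) :
    ∃ u : EuclideanSpace ℝ (Fin n) → ℝ, IsGelfandSol n lam u := by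
  have hcont : ContinuousOn (fun t : ℝ => (n : ℝ) * ((n : ℝ) - 2) * t / (1 + t) ^ 2)
      (Set.Icc 0 1) := by
    refine ContinuousOn.div (by fun_prop) (by fun_prop) fun t ht => ?_
    have := ht.1
    positivity
  obtain ⟨t, ht, hlam⟩ := intermediate_value_Icc zero_le_one hcont
    (show lam ∈ Set.Icc _ _ from ⟨by simpa using h0.le, by norm_num; linarith⟩)
  have ht0 : 0 < t := by
    refine lt_of_le_of_ne ht.1 ?_
    rintro rfl
    simp at hlam
    linarith
  refine ⟨gelfandProfile n t, contDiff_gelfandProfile ht.1, fun x hx => ?_, fun x _ => ?_,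
    fun x hx => ?_⟩
  · exact gelfandProfile_pos hn ht0 (by simpa using hx)
  · rw [laplacian_gelfandProfile hn ht.1, ← hlam]
  · exact gelfandProfile_eq_zero ht.1 (by simpa using hx)

/-- Sweeping the profiles upwards from `t = 0` below a solution, the first contact contradicts
the equation. -/
lemma not_isGelfandSol (hn : 3 ≤ n) {lam : ℝ} (hlam : (n : ℝ) * ((n : ℝ) - 2) / 4 < lam)
    (u : EuclideanSpace ℝ (Fin n) → ℝ) : ¬ IsGelfandSol n lam u := by
  rintro ⟨hsmooth, hupos, hpde, hubd⟩
  have hn' : (3 : ℝ) ≤ n := by exact_mod_cast hn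
  have hk : 0 < ((n : ℝ) - 2) / 2 := by linarith
  have hu2 : ContDiff ℝ 2 u := contDiff_infty.1 hsmooth 2
  set T : Set ℝ := {t | 0 ≤ t ∧
    ∀ x ∈ ball (0 : EuclideanSpace ℝ (Fin n)) 1, gelfandProfile n t x ≤ u x} with hT
  have hT0 : (0 : ℝ) ∈ T := ⟨le_rfl, fun x hx => by simpa [gelfandProfile] using (hupos x hx).le⟩
  have hTbdd : BddAbove T := by
    refine ⟨(1 + u 0) ^ (((n : ℝ) - 2) / 2)⁻¹, fun t ht => ?_⟩
    have h0 := ht.2 0 (by simp)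
    have h1 : (1 + t) ^ (((n : ℝ) - 2) / 2) ≤ 1 + u 0 := by
      rw [← one_add_gelfandProfile_zero]
      linarith
    have h1t : 0 ≤ 1 + t := by linarith [ht.1]
    have h2 := Real.rpow_le_rpow (by positivity) h1 (inv_nonneg.2 hk.le)
    rw [Real.rpow_rpow_inv h1t hk.ne'] at h2
    linarith
  set t := sSup T with htdef
  have ht0 : 0 ≤ t := le_csSup hTbdd hT0
  have htT : ∀ x ∈ ball (0 : EuclideanSpace ℝ (Fin n)) 1, gelfandProfile n t x ≤ u x := by
    intro x hx
    obtain ⟨s, -, hs, hsT⟩ := exists_seq_tendsto_sSup ⟨0, hT0⟩ hTbdd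
    exact le_of_tendsto ((continuousAt_gelfandProfile_param ht0 x).tendsto.comp hs)
      (Eventually.of_forall fun j => (hsT j).2 x hx)
  have hex : ∀ j : ℕ, ∃ y ∈ ball (0 : EuclideanSpace ℝ (Fin n)) 1,
      u y < gelfandProfile n (t + 1 / ((j : ℝ) + 1)) y := by
    intro j
    by_contra! hcon
    have hj : (0 : ℝ) < 1 / ((j : ℝ) + 1) := by positivity
    have := le_csSup hTbdd (show t + 1 / ((j : ℝ) + 1) ∈ T from ⟨by positivity, hcon⟩)
    linarith
  choose y hy huy using hex
  obtain ⟨x, -, φ, hφ, hyx⟩ :=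
    (isCompact_closedBall (0 : EuclideanSpace ℝ (Fin n)) 1).tendsto_subseq
    fun j => ball_subset_closedBall (hy j)
  have hv2 : ContDiff ℝ 2 (gelfandProfile n t) :=
    contDiff_infty.1 (contDiff_gelfandProfile ht0) 2
  have hδ : Tendsto (fun j => 1 / ((φ j : ℝ) + 1)) atTop (𝓝 0) :=
    tendsto_one_div_add_atTop_nhds_zero_nat.comp hφ.tendsto_atTop
  have hzpos : ∀ x ∈ closedBall (0 : EuclideanSpace ℝ (Fin n)) 1,
      0 ≤ u x - gelfandProfile n t x := by
    intro x hx
    rcases (mem_closedBall_zero_iff.1 hx).lt_or_eq with h | h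
    · exact sub_nonneg.2 (htT x (by simpa using h))
    · rw [hubd x (by simpa using h), gelfandProfile_eq_zero ht0 h, sub_zero]
  obtain ⟨hx, hzx, hdx⟩ := contact_of_tendsto (hu2.sub hv2) hzpos
    (fun x hx => by
      rw [hubd x hx, gelfandProfile_eq_zero ht0 (by simpa using hx), sub_zero])
    (ε := fun j => (1 + t) ^ (((n : ℝ) - 2) / 2) * (2 * n * (1 / ((φ j : ℝ) + 1))))
    (fun j => by simpa using hy (φ j)) hyx
    (by simpa using (hδ.const_mul (2 * (n : ℝ))).const_mul ((1 + t) ^ (((n : ℝ) - 2) / 2)))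
    (by
      have hsmall : ∀ᶠ j in atTop, (n : ℝ) * (1 / ((φ j : ℝ) + 1)) < 1 :=
        (hδ.const_mul (n : ℝ)).eventually_lt_const (by simp)
      filter_upwards [hsmall] with j hj
      have h1 := gelfandProfile_add_le hn ht0 (by positivity) hj.le
        (x := y (φ j)) (by simpa using (mem_ball_zero_iff.1 (hy (φ j))).le)
      have h2 := huy (φ j)
      simp only [Function.comp]
      linarith)
  have hlapz : 0 ≤ laplacian (fun y => u y - gelfandProfile n t y) x :=
    Finset.sum_nonneg fun i _ =>
      iteratedFDeriv_two_nonneg_of_contact (hu2.sub hv2) hzpos hx hzx hdx _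
  rw [laplacian_sub hu2 hv2] at hlapz
  have hux : u x = gelfandProfile n t x := sub_eq_zero.1 hzx
  have hbase : 0 < 1 + u x := by
    rw [hux]
    simp only [gelfandProfile, add_sub_cancel]
    positivity
  have hpdex : -laplacian u x = lam * (1 + u x) ^ (((n : ℝ) + 2) / ((n : ℝ) - 2)) := by
    have hleft := ((continuous_laplacian hu2).neg.tendsto x).comp hyx
    have hright := ((((continuous_const.add hsmooth.continuous).continuousAt (x := x)).rpow_const
      (p := ((n : ℝ) + 2) / ((n : ℝ) - 2)) (Or.inl hbase.ne')).const_mul lam).tendsto.comp hyx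
    exact tendsto_nhds_unique hleft (hright.congr fun j => (hpde _ (hy (φ j))).symm)
  have hpdev := laplacian_gelfandProfile hn ht0 x
  rw [← hux] at hpdev
  have hlamt : (n : ℝ) * ((n : ℝ) - 2) * t / (1 + t) ^ 2 < lam := by
    refine lt_of_le_of_lt ?_ hlam
    rw [div_le_div_iff₀ (by positivity) (by norm_num)]
    nlinarith [mul_nonneg (by nlinarith : (0 : ℝ) ≤ n * (n - 2)) (sq_nonneg (1 - t))]
  have hw := Real.rpow_pos_of_pos hbase (((n : ℝ) + 2) / ((n : ℝ) - 2))
  nlinarith [mul_lt_mul_of_pos_right hlamt hw]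

end Profile

/-- The extremal parameter of the Gelfand problem `-Δu = λ (1+u)^{(n+2)/(n-2)}`
on the unit ball of `ℝⁿ`, `n ≥ 3`, is `λ* = n(n-2)/4`: solutions exist for
`0 < λ ≤ n(n-2)/4` and for no `λ > n(n-2)/4`. -/
theorem stmt_19 (n : ℕ) (hn : 3 ≤ n) :
    (∀ lam : ℝ, 0 < lam → lam ≤ (n : ℝ) * ((n : ℝ) - 2) / 4 →
      ∃ u : EuclideanSpace ℝ (Fin n) → ℝ, IsGelfandSol n lam u) ∧
    (∀ lam : ℝ, (n : ℝ) * ((n : ℝ) - 2) / 4 < lam →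
      ¬ ∃ u : EuclideanSpace ℝ (Fin n) → ℝ, IsGelfandSol n lam u) := by
  exact ⟨fun lam h0 h1 => exists_isGelfandSol hn h0 h1,
    fun lam h ⟨u, hu⟩ => not_isGelfandSol hn h u hu⟩
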